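/- For every starting point x ∈ ℤ, P_x-almost surely, for every k ∈ ℤ the empirical frequency (1/j) Σ_{i=1}^j 1{𝔇_{β_i} = k} converges as j → ∞ to π(k) = λ^{k²}/Σ_{y∈ℤ} λ^{y²}; that is, π is the stationary distribution of the Markov chain (𝔇_{β_j})_{j≥1}. -/

import Mathlib

open MeasureTheory Filter ProbabilityTheory

noncomputable section

/-- One-step transition probability of the urn discrepancy chain with parameter `lam`:
from state `i`, jump to `i+1` with probability `lam^(2i-1)/(1+lam^(2i-1))` and to `i-1`
with probability `1/(1+lam^(2i-1))`. -/
def urnStep (lam : ℝ) (i j : ℤ) : ℝ :=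
  if j = i + 1 then lam ^ (2 * i - 1) / (1 + lam ^ (2 * i - 1))
  else if j = i - 1 then 1 / (1 + lam ^ (2 * i - 1))
  else 0

/-- `P` is the family of laws (indexed by the starting point) of the urn discrepancy
chain with parameter `lam`, characterized by its cylinder probabilities. -/
def IsUrnChain (lam : ℝ) (P : ℤ → Measure (ℕ → ℤ)) : Prop :=
  (∀ x, IsProbabilityMeasure (P x)) ∧
    ∀ (x : ℤ) (n : ℕ) (p : ℕ → ℤ),
      (P x {ω | ∀ i ≤ n, ω i = p i}).toReal =
        (if p 0 = x then (1 : ℝ) else 0) *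
          ∏ i ∈ Finset.range n, urnStep lam (p i) (p (i + 1))

/-- Number of down-steps of the path `ω` during the time interval `[1, j]`. -/
def downCount (ω : ℕ → ℤ) (j : ℕ) : ℕ :=
  ((Finset.Icc 1 j).filter fun ℓ => ω ℓ = ω (ℓ - 1) - 1).card

/-- `betaTime ω i` is the time of the `i`-th down-step of the path `ω`. -/
def betaTime (ω : ℕ → ℤ) (i : ℕ) : ℕ :=
  sInf {j | 1 ≤ j ∧ downCount ω j = i}

/-- The probability distribution `π(x) = lam^(x²) / Σ_y lam^(y²)` on `ℤ`. -/
def urnPi (lam : ℝ) (x : ℤ) : ℝ :=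
  lam ^ (x ^ 2) / ∑' y : ℤ, lam ^ (y ^ 2)

section UrnChain

variable {lam : ℝ} {P : ℤ → Measure (ℕ → ℤ)}

theorem urnStep_up (lam : ℝ) (i : ℤ) :
    urnStep lam i (i + 1) = lam ^ (2 * i - 1) / (1 + lam ^ (2 * i - 1)) := by
  simp [urnStep]

theorem urnStep_down (lam : ℝ) (i : ℤ) :
    urnStep lam i (i - 1) = 1 / (1 + lam ^ (2 * i - 1)) := by
  rw [urnStep, if_neg (by lia), if_pos rfl]

theorem urnStep_nonneg (h0 : 0 < lam) (i j : ℤ) : 0 ≤ urnStep lam i j := by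
  unfold urnStep
  split_ifs <;> positivity

theorem urnStep_up_add_down (h0 : 0 < lam) (i : ℤ) :
    urnStep lam i (i + 1) + urnStep lam i (i - 1) = 1 := by
  have : 0 < lam ^ (2 * i - 1) := by positivity
  rw [urnStep_up, urnStep_down]
  field_simp
  ring

/-- Cylinder probabilities satisfy the Markov recursion. -/
theorem IsUrnChain.cylinder_succ (hP : IsUrnChain lam P) (h0 : 0 < lam) (x : ℤ) (n : ℕ)
    (p : ℕ → ℤ) :
    P x {ω | ∀ i ≤ n + 1, ω i = p i} =
      P x {ω | ∀ i ≤ n, ω i = p i} * ENNReal.ofReal (urnStep lam (p n) (p (n + 1))) := by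
  have := hP.1 x
  rw [← ENNReal.toReal_eq_toReal_iff' (measure_ne_top _ _)
    (ENNReal.mul_ne_top (measure_ne_top _ _) ENNReal.ofReal_ne_top), ENNReal.toReal_mul,
    ENNReal.toReal_ofReal (urnStep_nonneg h0 _ _), hP.2, hP.2, Finset.prod_range_succ, mul_assoc]

theorem IsUrnChain.ae_zero (hP : IsUrnChain lam P) (x : ℤ) : ∀ᵐ ω ∂(P x), ω 0 = x := by
  have := hP.1 x
  have h := hP.2 x 0 fun _ => x
  have hm : MeasurableSet {ω : ℕ → ℤ | ω 0 = x} :=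
    measurableSet_eq_fun (by fun_prop) (by fun_prop)
  rw [ae_iff_measure_eq hm.nullMeasurableSet, measure_univ,
    ← ENNReal.toReal_eq_toReal_iff' (measure_ne_top _ _) ENNReal.one_ne_top]
  simpa using h

/-- Extension of a finite history to an infinite path. -/
def extendPath {n : ℕ} (p : Fin (n + 1) → ℤ) (i : ℕ) : ℤ :=
  if h : i < n + 1 then p ⟨i, h⟩ else 0

theorem extendPath_apply {n : ℕ} (ω : ℕ → ℤ) {i : ℕ} (hi : i ≤ n) :
    extendPath (fun j : Fin (n + 1) => ω j) i = ω i := by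
  simp [extendPath, Nat.lt_succ_of_le hi]

theorem setOf_history_eq {n : ℕ} (p : Fin (n + 1) → ℤ) :
    {ω : ℕ → ℤ | (fun j : Fin (n + 1) => ω j) = p} = {ω | ∀ i ≤ n, ω i = extendPath p i} := by
  ext ω
  constructor
  · rintro rfl i hi
    exact (extendPath_apply ω hi).symm
  · intro h
    funext j
    have := h j (by lia)
    simpa [extendPath, j.2] using this

theorem measurable_history (n : ℕ) :
    Measurable fun (ω : ℕ → ℤ) (j : Fin (n + 1)) => ω j :=
  measurable_pi_lambda _ fun _ => measurable_pi_apply _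

/-- One-step domination: an expectation at time `n + 1` is bounded by an expectation at time `n`
as soon as the conditional expectations are. -/
theorem IsUrnChain.lintegral_le_of_step (hP : IsUrnChain lam P) (h0 : 0 < lam) (x : ℤ) (n : ℕ)
    {f g : (ℕ → ℤ) → ENNReal}
    (hf : ∀ ω ω', (∀ i ≤ n + 1, ω i = ω' i) → f ω = f ω')
    (hg : ∀ ω ω', (∀ i ≤ n, ω i = ω' i) → g ω = g ω')
    (hfg : ∀ ω,
      ENNReal.ofReal (urnStep lam (ω n) (ω n + 1)) * f (Function.update ω (n + 1) (ω n + 1)) +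
      ENNReal.ofReal (urnStep lam (ω n) (ω n - 1)) * f (Function.update ω (n + 1) (ω n - 1))
        ≤ g ω) :
    ∫⁻ ω, f ω ∂(P x) ≤ ∫⁻ ω, g ω ∂(P x) := by
  let H : (ℕ → ℤ) → (Fin (n + 1) → ℤ) := fun ω j => ω j
  have hH : Measurable H := measurable_history n
  have hH' : Measurable fun ω : ℕ → ℤ => (H ω, ω (n + 1)) := hH.prodMk (measurable_pi_apply _)
  have hf' : ∀ ω, f ω = f (Function.update (extendPath (H ω)) (n + 1) (ω (n + 1))) := by
    intro ω
    refine hf _ _ fun i hi => ?_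
    rcases hi.eq_or_lt with rfl | hi
    · simp
    · rw [Function.update_of_ne hi.ne, extendPath_apply ω (by lia)]
  have hg' : ∀ ω, g ω = g (extendPath (H ω)) := fun ω =>
    hg _ _ fun i hi => (extendPath_apply ω hi).symm
  let F : (Fin (n + 1) → ℤ) × ℤ → ENNReal := fun q =>
    f (Function.update (extendPath q.1) (n + 1) q.2)
  have hmeas : ∀ (p : Fin (n + 1) → ℤ) (j : ℤ),
      (P x).map (fun ω => (H ω, ω (n + 1))) {(p, j)} =
      (P x).map H {p} * ENNReal.ofReal (urnStep lam (extendPath p n) j) := by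
    intro p j
    rw [Measure.map_apply hH' (measurableSet_singleton _),
      Measure.map_apply hH (measurableSet_singleton _)]
    have h1 : H ⁻¹' {p} =
        {ω | ∀ i ≤ n, ω i = Function.update (extendPath p) (n + 1) j i} := by
      refine (setOf_history_eq p).trans ?_
      ext ω
      refine forall₂_congr fun i hi => ?_
      rw [Function.update_of_ne (by lia)]
    have h2 : (fun ω : ℕ → ℤ => (H ω, ω (n + 1))) ⁻¹' {(p, j)} =
        {ω | ∀ i ≤ n + 1, ω i = Function.update (extendPath p) (n + 1) j i} := by
      ext ω
      have h3 := Set.ext_iff.1 h1 ω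
      simp only [Set.mem_preimage, Set.mem_singleton_iff, Set.mem_ofPred_eq, Prod.mk.injEq] at h3 ⊢
      rw [h3]
      constructor
      · rintro ⟨h, h'⟩ i hi
        rcases hi.eq_or_lt with rfl | hi
        · simpa using h'
        · exact h i (by lia)
      · intro h
        exact ⟨fun i hi => h i (by lia), by simpa using h (n + 1) le_rfl⟩
    rw [h1, h2, hP.cylinder_succ h0]
    simp
  calc ∫⁻ ω, f ω ∂(P x) = ∫⁻ ω, F (H ω, ω (n + 1)) ∂(P x) := lintegral_congr hf'
    _ = ∫⁻ q, F q ∂((P x).map fun ω => (H ω, ω (n + 1))) :=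
        (lintegral_map (measurable_of_countable F) hH').symm
    _ = ∑' p, ∑' j, F (p, j) * (P x).map (fun ω => (H ω, ω (n + 1))) {(p, j)} := by
        rw [lintegral_countable', ENNReal.tsum_prod']
    _ ≤ ∑' p, g (extendPath p) * (P x).map H {p} := by
        refine ENNReal.tsum_le_tsum fun p => ?_
        set m := extendPath p n with hm
        rw [tsum_eq_sum (s := {m + 1, m - 1}), Finset.sum_pair (by lia), hmeas, hmeas]
        · refine le_trans (le_of_eq ?_) (mul_le_mul_left (hfg (extendPath p)) _)
          simp only [F, ← hm]
          ring
        · intro j hj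
          simp only [Finset.mem_insert, Finset.mem_singleton, not_or] at hj
          rw [hmeas, urnStep, if_neg hj.1, if_neg hj.2]
          simp
    _ = ∫⁻ p, g (extendPath p) ∂((P x).map H) := by rw [lintegral_countable']
    _ = ∫⁻ ω, g (extendPath (H ω)) ∂(P x) := lintegral_map (measurable_of_countable _) hH
    _ = ∫⁻ ω, g ω ∂(P x) := (lintegral_congr hg').symm

theorem IsUrnChain.ae_step (hP : IsUrnChain lam P) (h0 : 0 < lam) (x : ℤ) :
    ∀ᵐ ω ∂(P x), ∀ n, ω (n + 1) = ω n + 1 ∨ ω (n + 1) = ω n - 1 := by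
  rw [ae_all_iff]
  intro n
  let S : Set (ℕ → ℤ) := {ω | ω (n + 1) = ω n + 1 ∨ ω (n + 1) = ω n - 1}
  have hS : MeasurableSet S :=
    ((measurableSet_eq_fun (by fun_prop) (by fun_prop)).union
      (measurableSet_eq_fun (by fun_prop) (by fun_prop)))
  have := hP.lintegral_le_of_step h0 x n (f := Sᶜ.indicator 1) (g := 0) ?_ (fun _ _ _ => rfl) ?_
  · rw [lintegral_indicator_one hS.compl] at this
    change P x Sᶜ = 0
    simpa using this
  · intro ω ω' h
    simp [S, Set.indicator, h n (by lia), h (n + 1) le_rfl]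
  · intro ω
    simp [S]

/-- A process with bounded increments whose second moments grow at most linearly is `o(n)`. -/
theorem ae_tendsto_div_of_sq_le {Ω : Type*} [MeasurableSpace Ω] {μ : Measure Ω}
    {Z : ℕ → Ω → ℝ} (hZ : ∀ n, Measurable (Z n)) {A B C : ℝ} (hA : 0 ≤ A) (hB : 0 ≤ B)
    (hsq : ∀ n : ℕ, ∫⁻ ω, ENNReal.ofReal (Z n ω ^ 2) ∂μ ≤ ENNReal.ofReal (A + B * n))
    (hinc : ∀ᵐ ω ∂μ, ∀ n, |Z (n + 1) ω - Z n ω| ≤ C) :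
    ∀ᵐ ω ∂μ, Tendsto (fun n : ℕ => Z n ω / n) atTop (nhds 0) := by
  have hsum : ∫⁻ ω, ∑' n : ℕ, ENNReal.ofReal ((Z ((n + 1) ^ 2) ω / ((n + 1) ^ 2 : ℕ)) ^ 2) ∂μ
      ≠ ⊤ := by
    rw [lintegral_tsum fun n => by fun_prop]
    have hle : ∀ n : ℕ,
        ∫⁻ ω, ENNReal.ofReal ((Z ((n + 1) ^ 2) ω / ((n + 1) ^ 2 : ℕ)) ^ 2) ∂μ ≤
          ENNReal.ofReal ((A + B) * (1 / ((n + 1 : ℕ) : ℝ) ^ 2)) := by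
      intro n
      have hn : (0 : ℝ) < ((n + 1) ^ 2 : ℕ) := by positivity
      have hn1 : (1 : ℝ) ≤ ((n + 1) ^ 2 : ℕ) := by exact_mod_cast Nat.one_le_pow _ _ (by lia)
      calc _ = ∫⁻ ω, ENNReal.ofReal (1 / (((n + 1) ^ 2 : ℕ) : ℝ) ^ 2) *
              ENNReal.ofReal (Z ((n + 1) ^ 2) ω ^ 2) ∂μ := by
            refine lintegral_congr fun ω => ?_
            rw [← ENNReal.ofReal_mul (by positivity)]
            congr 1
            field_simp
        _ ≤ ENNReal.ofReal (1 / (((n + 1) ^ 2 : ℕ) : ℝ) ^ 2) *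
              ENNReal.ofReal (A + B * ((n + 1) ^ 2 : ℕ)) := by
            rw [lintegral_const_mul _ (by fun_prop)]
            gcongr
            exact hsq _
        _ ≤ _ := by
            rw [← ENNReal.ofReal_mul (by positivity)]
            refine ENNReal.ofReal_le_ofReal ?_
            have : ((n + 1 : ℕ) : ℝ) ^ 2 = ((n + 1) ^ 2 : ℕ) := by push_cast; ring
            rw [this]
            set N : ℝ := (((n + 1) ^ 2 : ℕ) : ℝ)
            rw [div_mul_eq_mul_div, mul_one_div, div_le_div_iff₀ (by positivity) hn]
            nlinarith [mul_le_mul_of_nonneg_left hn1 hA]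
    refine ne_top_of_le_ne_top ?_ (ENNReal.tsum_le_tsum hle)
    have hs : Summable fun n : ℕ => (A + B) * (1 / ((n + 1 : ℕ) : ℝ) ^ 2) :=
      ((summable_nat_add_iff 1).2 (Real.summable_one_div_nat_pow.2 one_lt_two)).mul_left _
    rw [← ENNReal.ofReal_tsum_of_nonneg (fun n => by positivity) hs]
    exact ENNReal.ofReal_ne_top
  filter_upwards [ae_lt_top' (by fun_prop) hsum, hinc] with ω hω hC
  have hC0 : 0 ≤ C := (abs_nonneg _).trans (hC 0)
  have hsub : Tendsto (fun n : ℕ => |Z (n ^ 2) ω / (n ^ 2 : ℕ)|) atTop (nhds 0) := by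
    rw [← tendsto_add_atTop_iff_nat 1]
    have h1 := ENNReal.tendsto_atTop_zero_of_tsum_ne_top hω.ne
    have h2 := (ENNReal.tendsto_toReal ENNReal.zero_ne_top).comp h1
    have h3 := h2.sqrt
    simp only [Function.comp_def, ENNReal.toReal_zero, Real.sqrt_zero] at h3
    refine h3.congr fun n => ?_
    rw [ENNReal.toReal_ofReal (sq_nonneg _), Real.sqrt_sq_eq_abs]
  have hlip : ∀ n m : ℕ, |Z (n + m) ω - Z n ω| ≤ C * m := by
    intro n m
    induction m with
    | zero => simp
    | succ m ih =>
      have := abs_sub_le (Z (n + (m + 1)) ω) (Z (n + m) ω) (Z n ω)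
      have := hC (n + m)
      push_cast
      rw [add_assoc] at this
      linarith
  have hsqrt : Tendsto Nat.sqrt atTop atTop :=
    tendsto_atTop_atTop.2 fun b => ⟨b ^ 2, fun a ha => Nat.le_sqrt'.2 ha⟩
  have hbound : Tendsto (fun m : ℕ => |Z (m.sqrt ^ 2) ω / (m.sqrt ^ 2 : ℕ)| +
      2 * C / (m.sqrt : ℝ)) atTop (nhds 0) := by
    have h := (hsub.add ((tendsto_const_div_atTop_nhds_zero_nat (2 * C)))).comp hsqrt
    simpa [Function.comp_def] using h
  rw [tendsto_zero_iff_abs_tendsto_zero]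
  refine squeeze_zero' (Eventually.of_forall fun m => abs_nonneg _) ?_ hbound
  filter_upwards [eventually_ge_atTop 1] with m hm
  have hs : 0 < m.sqrt := Nat.sqrt_pos.2 hm
  have hle : m.sqrt ^ 2 ≤ m := Nat.sqrt_le' m
  obtain ⟨r, hr⟩ := Nat.exists_eq_add_of_le hle
  have hr2 : r ≤ 2 * m.sqrt := by
    have := Nat.lt_succ_sqrt' m
    rw [Nat.succ_eq_add_one, add_sq] at this
    lia
  have h1 : |Z m ω| ≤ |Z (m.sqrt ^ 2) ω| + C * (2 * m.sqrt) := by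
    have h2 := hlip (m.sqrt ^ 2) r
    rw [← hr] at h2
    have h3 := abs_sub_abs_le_abs_sub (Z m ω) (Z (m.sqrt ^ 2) ω)
    have h4 : C * r ≤ C * (2 * m.sqrt) := by
      gcongr
      exact_mod_cast hr2
    linarith
  have hs' : (0 : ℝ) < m.sqrt := by exact_mod_cast hs
  have hle' : ((m.sqrt ^ 2 : ℕ) : ℝ) ≤ m := by exact_mod_cast hle
  have hpos : (0 : ℝ) < ((m.sqrt ^ 2 : ℕ) : ℝ) := by positivity
  calc |Z m ω / m| = |Z m ω| / m := by rw [abs_div, Nat.abs_cast]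
    _ ≤ (|Z (m.sqrt ^ 2) ω| + C * (2 * m.sqrt)) / (m.sqrt ^ 2 : ℕ) := by gcongr
    _ = _ := by
      rw [abs_div, Nat.abs_cast]
      push_cast
      field_simp

/-- Number of down-steps landing at `k` during the time interval `[1, n]`. -/
def landCount (ω : ℕ → ℤ) (k : ℤ) (n : ℕ) : ℕ :=
  ((Finset.Icc 1 n).filter fun ℓ => ω ℓ = ω (ℓ - 1) - 1 ∧ ω ℓ = k).card

theorem card_filter_Icc_succ (p : ℕ → Prop) [DecidablePred p] (n : ℕ) :
    ((Finset.Icc 1 (n + 1)).filter p).card =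
      ((Finset.Icc 1 n).filter p).card + if p (n + 1) then 1 else 0 := by
  rw [← Finset.insert_Icc_right_eq_Icc_add_one (by lia), Finset.filter_insert]
  split_ifs
  · rw [Finset.card_insert_of_notMem (by simp)]
  · rfl

theorem downCount_zero (ω : ℕ → ℤ) : downCount ω 0 = 0 := by simp [downCount]

theorem downCount_succ (ω : ℕ → ℤ) (n : ℕ) :
    downCount ω (n + 1) = downCount ω n + if ω (n + 1) = ω n - 1 then 1 else 0 :=
  card_filter_Icc_succ _ n

theorem landCount_zero (ω : ℕ → ℤ) (k : ℤ) : landCount ω k 0 = 0 := by simp [landCount]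

theorem landCount_succ (ω : ℕ → ℤ) (k : ℤ) (n : ℕ) :
    landCount ω k (n + 1) =
      landCount ω k n + if ω (n + 1) = ω n - 1 ∧ ω (n + 1) = k then 1 else 0 :=
  card_filter_Icc_succ _ n

theorem downCount_mono (ω : ℕ → ℤ) : Monotone (downCount ω) :=
  monotone_nat_of_le_succ fun n => by rw [downCount_succ]; lia

theorem downCount_le (ω : ℕ → ℤ) (n : ℕ) : downCount ω n ≤ n :=
  (Finset.card_filter_le _ _).trans (by simp)

theorem betaTime_of_downStep {ω : ℕ → ℤ} {n : ℕ} (h : ω (n + 1) = ω n - 1) :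
    betaTime ω (downCount ω n + 1) = n + 1 := by
  have hmem : n + 1 ∈ {j | 1 ≤ j ∧ downCount ω j = downCount ω n + 1} :=
    ⟨by lia, by rw [downCount_succ, if_pos h]⟩
  refine le_antisymm (Nat.sInf_le hmem) ?_
  by_contra! hlt
  have h1 := (Nat.sInf_mem ⟨_, hmem⟩).2
  have h2 := downCount_mono ω (Nat.lt_succ_iff.1 hlt)
  unfold betaTime at h2
  lia

theorem card_filter_betaTime (ω : ℕ → ℤ) (k : ℤ) (n : ℕ) :
    ((Finset.Icc 1 (downCount ω n)).filter fun i => ω (betaTime ω i) = k).card =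
      landCount ω k n := by
  induction n with
  | zero => simp [downCount_zero, landCount_zero]
  | succ n ih =>
    rw [downCount_succ, landCount_succ]
    by_cases h : ω (n + 1) = ω n - 1
    · rw [if_pos h, card_filter_Icc_succ, ih, betaTime_of_downStep h]
      simp [h]
    · simp [h, ih]

theorem downCount_eq {ω : ℕ → ℤ} (hω : ∀ n, ω (n + 1) = ω n + 1 ∨ ω (n + 1) = ω n - 1) (n : ℕ) :
    2 * (downCount ω n : ℤ) = n - ω n + ω 0 := by
  induction n with
  | zero => simp [downCount_zero]
  | succ n ih =>
    rw [downCount_succ]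
    rcases hω n with h | h
    · rw [if_neg (by lia), h]
      push_cast
      linarith
    · rw [if_pos h, h]
      push_cast
      linarith

theorem exists_downCount_eq {ω : ℕ → ℤ} (h : Tendsto (downCount ω) atTop atTop) (j : ℕ) :
    ∃ n, downCount ω n = j := by
  induction j with
  | zero => exact ⟨0, downCount_zero ω⟩
  | succ j ih =>
    have hex : ∃ n, j + 1 ≤ downCount ω n := (h.eventually_ge_atTop (j + 1)).exists
    classical
    refine ⟨Nat.find hex, le_antisymm ?_ (Nat.find_spec hex)⟩
    rcases hn : Nat.find hex with _ | n
    · simp [downCount_zero]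
    · have := Nat.find_min hex (m := n) (by lia)
      rw [downCount_succ]
      split_ifs <;> lia

theorem tendsto_frequency_of_path {ω : ℕ → ℤ} {k : ℤ} {c : ℝ}
    (hω : ∀ n, ω (n + 1) = ω n + 1 ∨ ω (n + 1) = ω n - 1)
    (hlin : Tendsto (fun n : ℕ => (ω n : ℝ) / n) atTop (nhds 0))
    (hland : Tendsto (fun n : ℕ => ((landCount ω k n : ℝ) - c * downCount ω n) / n) atTop
      (nhds 0)) :
    Tendsto (fun j : ℕ =>
      (((Finset.Icc 1 j).filter fun i => ω (betaTime ω i) = k).card : ℝ) / (j : ℝ))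
      atTop (nhds c) := by
  have hdown : Tendsto (fun n : ℕ => (downCount ω n : ℝ) / n) atTop (nhds (1 / 2)) := by
    have h := ((hlin.const_sub 1).add
      (tendsto_const_div_atTop_nhds_zero_nat (ω 0 : ℝ))).div_const 2
    rw [sub_zero, add_zero] at h
    refine h.congr' ?_
    filter_upwards [eventually_gt_atTop 0] with n hn
    have hn' : (0 : ℝ) < n := by exact_mod_cast hn
    have h2 : 2 * (downCount ω n : ℝ) = n - ω n + ω 0 := by exact_mod_cast downCount_eq hω n
    field_simp
    linarith
  have hdown_top : Tendsto (downCount ω) atTop atTop := by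
    rw [← tendsto_natCast_atTop_iff (R := ℝ)]
    refine (hdown.pos_mul_atTop (by norm_num) tendsto_natCast_atTop_atTop).congr' ?_
    filter_upwards [eventually_gt_atTop 0] with n hn
    have hn' : (0 : ℝ) < n := by exact_mod_cast hn
    field_simp
  have hratio : Tendsto (fun n => (landCount ω k n : ℝ) / downCount ω n) atTop (nhds c) := by
    have h := (hland.div hdown (by norm_num)).add_const c
    rw [zero_div, zero_add] at h
    refine h.congr' ?_
    filter_upwards [eventually_gt_atTop 0, hdown_top.eventually_gt_atTop 0] with n hn hd
    have hn' : (0 : ℝ) < n := by exact_mod_cast hn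
    have hd' : (0 : ℝ) < downCount ω n := by exact_mod_cast hd
    simp only [Pi.div_apply]
    field_simp
    ring
  choose b hb using exists_downCount_eq hdown_top
  have hb_top : Tendsto b atTop atTop :=
    tendsto_atTop_mono (fun j => (hb j).symm.le.trans (downCount_le ω _)) tendsto_id
  refine (hratio.comp hb_top).congr fun j => ?_
  rw [Function.comp_apply, ← card_filter_betaTime, hb]

theorem exists_int_antidifference (d : ℤ → ℝ) : ∃ h : ℤ → ℝ, ∀ i, h (i + 1) - h i = d i := by
  refine ⟨fun i => ∑ j ∈ Finset.range i.toNat, d j -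
    ∑ j ∈ Finset.range (-i).toNat, d (-(j : ℤ) - 1), fun i => ?_⟩
  rcases le_or_gt 0 i with hi | hi
  · lift i to ℕ using hi
    have h1 : ((i : ℤ) + 1).toNat = i + 1 := by lia
    have h2 : (-((i : ℤ) + 1)).toNat = 0 := by lia
    have h3 : (-(i : ℤ)).toNat = 0 := by lia
    simp only [h1, h2, h3, Finset.sum_range_succ]
    simp
  · obtain ⟨n, rfl⟩ : ∃ n : ℕ, i = -(n : ℤ) - 1 := ⟨(-i - 1).toNat, by lia⟩
    have h1 : (-(n : ℤ) - 1).toNat = 0 := by lia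
    have h2 : (-(-(n : ℤ) - 1)).toNat = n + 1 := by lia
    have h3 : (-(n : ℤ) - 1 + 1).toNat = 0 := by lia
    have h4 : (-(-(n : ℤ) - 1 + 1)).toNat = n := by lia
    simp only [h1, h2, h3, h4, Finset.sum_range_succ]
    simp

theorem abs_le_of_int_lipschitz {h : ℤ → ℝ} {C : ℝ} (hC : ∀ i, |h (i + 1) - h i| ≤ C) (i : ℤ) :
    |h i| ≤ |h 0| + C * |(i : ℝ)| := by
  induction i using Int.induction_on with
  | zero => simp
  | succ i ih =>
    have h1 := hC i
    have h2 := abs_sub_abs_le_abs_sub (h (i + 1)) (h i)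
    push_cast at ih ⊢
    rw [Nat.abs_cast] at ih
    rw [abs_of_nonneg (by positivity : (0 : ℝ) ≤ i + 1)]
    linarith
  | pred i ih =>
    have h1 := hC (-i - 1)
    rw [sub_add_cancel, abs_sub_comm] at h1
    have h2 := abs_sub_abs_le_abs_sub (h (-i - 1)) (h (-i))
    push_cast at ih ⊢
    rw [abs_neg, Nat.abs_cast] at ih
    rw [← neg_add' (i : ℝ), abs_neg, abs_of_nonneg (by positivity : (0 : ℝ) ≤ i + 1)]
    linarith

theorem summable_pow_natAbs (h0 : 0 < lam) (h1 : lam < 1) :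
    Summable fun m : ℤ => lam ^ m.natAbs := by
  have := summable_geometric_of_lt_one h0.le h1
  exact Summable.of_nat_of_neg (by simpa using this) (by simpa using this)

theorem zpow_sq_le (h0 : 0 < lam) (h1 : lam < 1) {i m : ℤ} (him : i ^ 2 + |m - i| ≤ m ^ 2) :
    lam ^ (m ^ 2) ≤ lam ^ (i ^ 2) * lam ^ (m - i).natAbs := by
  rw [← zpow_natCast, ← zpow_add₀ h0.ne', Int.natCast_natAbs]
  exact zpow_le_zpow_right_of_le_one₀ h0 h1.le him

theorem summable_zpow_sq (h0 : 0 < lam) (h1 : lam < 1) : Summable fun m : ℤ => lam ^ (m ^ 2) := by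
  refine (summable_pow_natAbs h0 h1).of_nonneg_of_le (fun m => by positivity) fun m => ?_
  have h := zpow_sq_le h0 h1 (i := 0) (m := m) ?_
  · simpa using h
  · have := sq_abs m
    rcases abs_cases m with ⟨h, _⟩ | ⟨h, _⟩ <;> simp only [sub_zero, h] <;> nlinarith

/-- A partial sum of the weights `lam ^ m²` over integers further from the origin than `i`, on the
same side as `i`, is comparable with its leading term. -/
theorem tsum_ite_zpow_sq_le (h0 : 0 < lam) (h1 : lam < 1) (i : ℤ) (p : ℤ → Prop) [DecidablePred p]
    (hp : ∀ m, p m → i ^ 2 + |m - i| ≤ m ^ 2) :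
    ∑' m : ℤ, (if p m then lam ^ (m ^ 2) else 0) ≤
      lam ^ (i ^ 2) * ∑' m : ℤ, lam ^ m.natAbs := by
  have hs := summable_pow_natAbs h0 h1
  have hs' : Summable fun m : ℤ => lam ^ (m - i).natAbs :=
    (Equiv.subRight i).summable_iff (f := fun m : ℤ => lam ^ m.natAbs) |>.2 hs
  have hshift : ∑' m : ℤ, lam ^ (m - i).natAbs = ∑' m : ℤ, lam ^ m.natAbs :=
    (Equiv.subRight i).tsum_eq fun m : ℤ => lam ^ m.natAbs
  rw [← hshift, ← tsum_mul_left]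
  have hle : ∀ m : ℤ, (if p m then lam ^ (m ^ 2) else 0) ≤
      lam ^ (i ^ 2) * lam ^ (m - i).natAbs := by
    intro m
    split_ifs with h
    · exact zpow_sq_le h0 h1 (hp m h)
    · positivity
  refine Summable.tsum_le_tsum hle ?_ (hs'.mul_left _)
  refine (hs'.mul_left (lam ^ (i ^ 2))).of_nonneg_of_le (fun m => ?_) hle
  split_ifs <;> positivity

/-- Bounded solution `d` (in difference form) of the Poisson equation for landings at `k`. -/
theorem exists_poisson_difference (h0 : 0 < lam) (h1 : lam < 1) (k : ℤ) :
    ∃ (d : ℤ → ℝ) (C : ℝ), (∀ i, |d i| ≤ C) ∧ ∀ i,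
      lam ^ (2 * i - 1) * d i - d (i - 1) = urnPi lam k - if i - 1 = k then 1 else 0 := by
  set w : ℤ → ℝ := fun m => lam ^ (m ^ 2) with hw
  have hwpos : ∀ m, 0 < w m := fun m => by positivity
  have hsum : Summable w := summable_zpow_sq h0 h1
  have hsumI : ∀ (p : ℤ → Prop) [DecidablePred p], Summable fun m => if p m then w m else 0 := by
    intro p _
    refine hsum.of_nonneg_of_le (fun m => ?_) fun m => ?_
    · split_ifs
      exacts [(hwpos m).le, le_rfl]
    · split_ifs
      exacts [le_rfl, (hwpos m).le]
  have hZ : 0 < ∑' m, w m := hsum.tsum_pos (fun m => (hwpos m).le) 0 (hwpos 0)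
  set c : ℝ := urnPi lam k with hc
  have hcZ : w k = c * ∑' m, w m := (div_mul_cancel₀ _ hZ.ne').symm
  have hc0 : 0 ≤ c := (div_pos (hwpos k) hZ).le
  let F : ℤ → ℝ := fun i => ∑' m : ℤ, if m < i then w m else 0
  let G : ℤ → ℝ := fun i => ∑' m : ℤ, if i ≤ m then w m else 0
  have hF0 : ∀ i, 0 ≤ F i := fun i => tsum_nonneg fun m => by
    split_ifs
    exacts [(hwpos m).le, le_rfl]
  have hG0 : ∀ i, 0 ≤ G i := fun i => tsum_nonneg fun m => by
    split_ifs
    exacts [(hwpos m).le, le_rfl]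
  have hFG : ∀ i, F i + G i = ∑' m, w m := by
    intro i
    rw [← (hsumI _).tsum_add (hsumI _)]
    refine tsum_congr fun m => ?_
    by_cases h : m < i
    · simp [h]
    · simp [h, not_lt.1 h]
  have hFsucc : ∀ i, F i = F (i - 1) + w (i - 1) := by
    intro i
    rw [← tsum_ite_eq (i - 1) w, ← (hsumI _).tsum_add (hsumI _)]
    refine tsum_congr fun m => ?_
    rcases lt_trichotomy m (i - 1) with h | rfl | h
    · simp [h, h.ne, (by lia : m < i)]
    · simp
    · simp [h.not_gt, h.ne', (by lia : ¬ m < i)]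
  let d : ℤ → ℝ := fun i => (c * F i - if k < i then w k else 0) / w i
  set K : ℝ := ∑' m : ℤ, lam ^ m.natAbs
  have hK : 0 ≤ K := tsum_nonneg fun m => by positivity
  have hS : 0 ≤ ∑ j ∈ Finset.Icc (-|k|) |k|, |d j| := Finset.sum_nonneg fun _ _ => abs_nonneg _
  refine ⟨d, c * K + ∑ j ∈ Finset.Icc (-|k|) |k|, |d j|, fun i => ?_, fun i => ?_⟩
  · by_cases hi : i ∈ Finset.Icc (-|k|) |k|
    · have := Finset.single_le_sum (f := fun j => |d j|) (fun _ _ => abs_nonneg _) hi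
      have : 0 ≤ c * K := by positivity
      linarith
    have hcK : 0 ≤ c * K := by positivity
    refine le_trans ?_ (le_add_of_nonneg_right hS)
    rw [Finset.mem_Icc, not_and_or, not_le, not_le] at hi
    simp only [d]
    rw [abs_div, abs_of_pos (hwpos i), div_le_iff₀ (hwpos i)]
    rcases hi with hi | hi
    · have hb : F i ≤ w i * K := tsum_ite_zpow_sq_le h0 h1 i (fun m => m < i) fun m hm => by
        rw [abs_of_neg (by lia)]
        have := abs_nonneg k
        nlinarith
      rw [if_neg (by have := neg_abs_le k; lia), sub_zero, abs_of_nonneg (mul_nonneg hc0 (hF0 i))]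
      nlinarith
    · have hb : G i ≤ w i * K := tsum_ite_zpow_sq_le h0 h1 i (fun m => i ≤ m) fun m hm => by
        rw [abs_of_nonneg (by lia)]
        have := abs_nonneg k
        nlinarith
      rw [if_pos (by have := le_abs_self k; lia), hcZ, ← hFG i, ← mul_sub, sub_add_cancel_left,
        mul_neg, abs_neg, abs_of_nonneg (mul_nonneg hc0 (hG0 i))]
      nlinarith
  · have hwi : w i = w (i - 1) * lam ^ (2 * i - 1) := by
      simp only [hw]
      rw [← zpow_add₀ h0.ne']
      congr 1
      ring
    have hr : 0 < lam ^ (2 * i - 1) := by positivity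
    have hwp := hwpos (i - 1)
    have hind : (if k < i then w k else 0) =
        (if k < i - 1 then w k else 0) + (if i - 1 = k then 1 else 0) * w (i - 1) := by
      rcases lt_trichotomy k (i - 1) with h | rfl | h
      · simp [h, h.ne', (by lia : k < i)]
      · simp
      · simp [h.not_gt, h.ne, (by lia : ¬ k < i)]
    simp only [d]
    rw [hwi, hFsucc i, hind]
    field_simp
    ring

theorem exists_poisson_solution (h0 : 0 < lam) (h1 : lam < 1) (k : ℤ) :
    ∃ (h : ℤ → ℝ) (C : ℝ), (∀ i, |h (i + 1) - h i| ≤ C) ∧ ∀ i,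
      urnStep lam i (i + 1) * (h (i + 1) - h i) +
      urnStep lam i (i - 1) * ((if i - 1 = k then 1 else 0) - urnPi lam k + (h (i - 1) - h i))
        = 0 := by
  obtain ⟨d, C, hC, hd⟩ := exists_poisson_difference h0 h1 k
  obtain ⟨h, hh⟩ := exists_int_antidifference d
  refine ⟨h, C, fun i => hh i ▸ hC i, fun i => ?_⟩
  have h1 := hh (i - 1)
  rw [sub_add_cancel] at h1
  have hr : 0 < lam ^ (2 * i - 1) := by positivity
  rw [urnStep_up, urnStep_down, hh, ← neg_sub (h i), h1]
  field_simp
  linarith [hd i]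

theorem measurable_of_history {n : ℕ} {f : (ℕ → ℤ) → ℝ}
    (hf : ∀ ω ω', (∀ i ≤ n, ω i = ω' i) → f ω = f ω') : Measurable f := by
  have h : f = (fun p : Fin (n + 1) → ℤ => f (extendPath p)) ∘ fun ω j => ω j :=
    funext fun ω => hf _ _ fun i hi => (extendPath_apply ω hi).symm
  rw [h]
  exact (measurable_of_countable _).comp (measurable_history n)

/-- An additive functional of the chain with bounded increments, whose drift never points away from
the origin, is almost surely `o(n)`. -/
theorem IsUrnChain.ae_tendsto_div (hP : IsUrnChain lam P) (h0 : 0 < lam) (x : ℤ)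
    {Z : ℕ → (ℕ → ℤ) → ℝ} {z : ℤ → ℝ} {δ : ℤ → ℤ → ℝ} {C : ℝ}
    (hZ0 : ∀ ω, Z 0 ω = z (ω 0)) (hZ : ∀ n ω, Z (n + 1) ω = Z n ω + δ (ω n) (ω (n + 1)))
    (hup : ∀ i, |δ i (i + 1)| ≤ C) (hdown : ∀ i, |δ i (i - 1)| ≤ C)
    (hdrift : ∀ n ω, Z n ω * (urnStep lam (ω n) (ω n + 1) * δ (ω n) (ω n + 1) +
      urnStep lam (ω n) (ω n - 1) * δ (ω n) (ω n - 1)) ≤ 0) :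
    ∀ᵐ ω ∂(P x), Tendsto (fun n : ℕ => Z n ω / n) atTop (nhds 0) := by
  have := hP.1 x
  have hadapt : ∀ n ω ω', (∀ i ≤ n, ω i = ω' i) → Z n ω = Z n ω' := by
    intro n
    induction n with
    | zero => intro ω ω' h; rw [hZ0, hZ0, h 0 le_rfl]
    | succ n ih =>
      intro ω ω' h
      rw [hZ, hZ, ih ω ω' fun i hi => h i (by lia), h n (by lia), h (n + 1) le_rfl]
  have hupdate : ∀ n ω j, Z (n + 1) (Function.update ω (n + 1) j) = Z n ω + δ (ω n) j := by
    intro n ω j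
    rw [hZ, hadapt n _ ω fun i hi => Function.update_of_ne (by lia) _ _,
      Function.update_of_ne (by lia), Function.update_self]
  have hC0 : 0 ≤ C := (abs_nonneg _).trans (hup 0)
  refine ae_tendsto_div_of_sq_le (fun n => measurable_of_history (hadapt n))
    (sq_nonneg (z x)) (sq_nonneg C) (fun n => ?_) ?_ (C := C)
  · induction n with
    | zero =>
      have h : ∀ᵐ ω ∂(P x), ENNReal.ofReal (Z 0 ω ^ 2) = ENNReal.ofReal (z x ^ 2) := by
        filter_upwards [hP.ae_zero x] with ω hω
        rw [hZ0, hω]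
      rw [lintegral_congr_ae h]
      simp
    | succ n ih =>
      calc ∫⁻ ω, ENNReal.ofReal (Z (n + 1) ω ^ 2) ∂(P x)
          ≤ ∫⁻ ω, ENNReal.ofReal (Z n ω ^ 2 + C ^ 2) ∂(P x) := by
            refine hP.lintegral_le_of_step h0 x n (fun ω ω' h => by rw [hadapt _ ω ω' h])
              (fun ω ω' h => by rw [hadapt _ ω ω' h]) fun ω => ?_
            have hu := urnStep_nonneg h0 (ω n) (ω n + 1)
            have hd := urnStep_nonneg h0 (ω n) (ω n - 1)
            rw [hupdate, hupdate, ← ENNReal.ofReal_mul hu, ← ENNReal.ofReal_mul hd,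
              ← ENNReal.ofReal_add (by positivity) (by positivity)]
            refine ENNReal.ofReal_le_ofReal ?_
            have h1 := urnStep_up_add_down h0 (ω n)
            have h2 := hdrift n ω
            have h3 := mul_le_mul_of_nonneg_left (sq_le_sq' (abs_le.1 (hup (ω n))).1
              (abs_le.1 (hup (ω n))).2) hu
            have h4 := mul_le_mul_of_nonneg_left (sq_le_sq' (abs_le.1 (hdown (ω n))).1
              (abs_le.1 (hdown (ω n))).2) hd
            have h5 : Z n ω ^ 2 + C ^ 2 = (urnStep lam (ω n) (ω n + 1) +
              urnStep lam (ω n) (ω n - 1)) * (Z n ω ^ 2 + C ^ 2) := by rw [h1, one_mul]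
            rw [h5]
            linarith
        _ = ∫⁻ ω, ENNReal.ofReal (Z n ω ^ 2) ∂(P x) + ENNReal.ofReal (C ^ 2) := by
            simp_rw [fun ω => ENNReal.ofReal_add (sq_nonneg (Z n ω)) (sq_nonneg C)]
            rw [lintegral_add_right _ measurable_const]
            simp
        _ ≤ ENNReal.ofReal (z x ^ 2 + C ^ 2 * n) + ENNReal.ofReal (C ^ 2) := by gcongr
        _ = _ := by
            rw [← ENNReal.ofReal_add (by positivity) (by positivity)]
            push_cast
            ring_nf
  · filter_upwards [hP.ae_step h0 x] with ω hω n
    rw [hZ, add_sub_cancel_left]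
    rcases hω n with h | h <;> rw [h]
    exacts [hup _, hdown _]

/-- The restoring drift of the chain points towards the origin. -/
theorem mul_urnStep_sub_nonpos (h0 : 0 < lam) (h1 : lam < 1) (i : ℤ) :
    (i : ℝ) * (urnStep lam i (i + 1) - urnStep lam i (i - 1)) ≤ 0 := by
  have hr : 0 < lam ^ (2 * i - 1) := by positivity
  rw [urnStep_up, urnStep_down, ← sub_div]
  rcases le_or_gt i 0 with hi | hi
  · refine mul_nonpos_of_nonpos_of_nonneg (by exact_mod_cast hi)
      (div_nonneg (sub_nonneg.2 ?_) (by positivity))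
    exact one_le_zpow_of_nonpos₀ h0 h1.le (by lia)
  · refine mul_nonpos_of_nonneg_of_nonpos (by exact_mod_cast hi.le)
      (div_nonpos_of_nonpos_of_nonneg (sub_nonpos.2 ?_) (by positivity))
    exact zpow_le_one₀ h0 h1.le (by lia)

theorem IsUrnChain.ae_tendsto_state_div (hP : IsUrnChain lam P) (h0 : 0 < lam) (h1 : lam < 1)
    (x : ℤ) : ∀ᵐ ω ∂(P x), Tendsto (fun n : ℕ => (ω n : ℝ) / n) atTop (nhds 0) := by
  refine hP.ae_tendsto_div h0 x (Z := fun n ω => (ω n : ℝ)) (z := fun i => (i : ℝ))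
    (δ := fun i j => (j : ℝ) - i) (C := 1) (fun ω => rfl) (fun n ω => by ring) (fun i => by simp)
    (fun i => by simp) fun n ω => ?_
  have h := mul_urnStep_sub_nonpos h0 h1 (ω n)
  push_cast
  linarith

theorem IsUrnChain.ae_tendsto_landCount (hP : IsUrnChain lam P) (h0 : 0 < lam) (h1 : lam < 1)
    (x k : ℤ) : ∀ᵐ ω ∂(P x), Tendsto
      (fun n : ℕ => ((landCount ω k n : ℝ) - urnPi lam k * downCount ω n) / n) atTop
      (nhds 0) := by
  obtain ⟨h, C, hC, hpoisson⟩ := exists_poisson_solution h0 h1 k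
  have hC0 : 0 ≤ C := (abs_nonneg _).trans (hC 0)
  set c := urnPi lam k
  let δ : ℤ → ℤ → ℝ := fun i j =>
    (if j = i - 1 then (if j = k then 1 else 0) - c else 0) + (h j - h i)
  have hδup : ∀ i, δ i (i + 1) = h (i + 1) - h i := by
    intro i
    simp only [δ]
    rw [if_neg (by lia), zero_add]
  have hδdown : ∀ i, δ i (i - 1) = (if i - 1 = k then 1 else 0) - c + (h (i - 1) - h i) := by
    intro i
    simp [δ]
  have hmart := hP.ae_tendsto_div h0 x
    (Z := fun n ω => (landCount ω k n : ℝ) - c * downCount ω n + (h (ω n) - h (ω 0)))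
    (z := 0) (δ := δ) (C := 1 + |c| + C)
    (fun ω => by simp [landCount_zero, downCount_zero])
    (fun n ω => by
      simp only [landCount_succ, downCount_succ, δ, ite_and]
      split_ifs <;> push_cast <;> ring)
    (fun i => by
      rw [hδup]
      linarith [hC i, abs_nonneg c])
    (fun i => by
      rw [hδdown]
      have h2 := hC (i - 1)
      rw [sub_add_cancel, abs_sub_comm] at h2
      have h3 : |(if i - 1 = k then (1 : ℝ) else 0)| ≤ 1 := by split_ifs <;> simp
      exact (abs_add_le _ _).trans (add_le_add ((abs_sub _ _).trans (by gcongr)) h2))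
    (fun n ω => by rw [hδup, hδdown, hpoisson, mul_zero])
  filter_upwards [hmart, hP.ae_tendsto_state_div h0 h1 x] with ω hω hlin
  have hh : Tendsto (fun n : ℕ => (h (ω n) - h (ω 0)) / n) atTop (nhds 0) := by
    rw [tendsto_zero_iff_abs_tendsto_zero]
    have hb : Tendsto (fun n : ℕ => C * |(ω n : ℝ) / n| + (|h 0| + |h (ω 0)|) / n) atTop
        (nhds 0) := by
      simpa using (hlin.abs.const_mul C).add
        (tendsto_const_div_atTop_nhds_zero_nat (|h 0| + |h (ω 0)|))
    refine squeeze_zero (fun n => abs_nonneg _) (fun n => ?_) hb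
    simp only [Function.comp_apply]
    rw [abs_div, abs_div, Nat.abs_cast, ← mul_div_assoc, ← add_div]
    gcongr
    have h2 := abs_le_of_int_lipschitz hC (ω n)
    have h3 := abs_sub (h (ω n)) (h (ω 0))
    linarith
  have hsub := hω.sub hh
  rw [sub_zero] at hsub
  refine hsub.congr fun n => ?_
  ring

end UrnChain

/-- Ergodic theorem: `π` is the stationary distribution of `(𝔇_{β_j})_{j≥1}`; the empirical
frequencies of `(𝔇_{β_j})` converge to `π` almost surely, for every starting point. -/
theorem urn_beta_ergodic (lam : ℝ) (hlam : lam ∈ Set.Ioo (0 : ℝ) 1)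
    (P : ℤ → Measure (ℕ → ℤ)) (hP : IsUrnChain lam P) :
    ∀ x : ℤ, ∀ᵐ ω ∂(P x), ∀ k : ℤ,
      Tendsto
        (fun j : ℕ =>
          (((Finset.Icc 1 j).filter fun i => ω (betaTime ω i) = k).card : ℝ) / (j : ℝ))
        atTop (nhds (urnPi lam k)) := by
  obtain ⟨h0, h1⟩ := hlam
  intro x
  have hland := ae_all_iff.2 fun k => hP.ae_tendsto_landCount h0 h1 x k
  filter_upwards [hP.ae_step h0 x, hP.ae_tendsto_state_div h0 h1 x, hland] with ω hω hlin hl k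
  exact tendsto_frequency_of_path hω hlin (hl k)
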